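/- Every right special trapezoidal word over {a,b} is Sturmian. (A trapezoidal word w is right special if both wa and wb are trapezoidal.) -/

import Mathlib

/-- The two-letter alphabet {a, b}. -/
inductive AB : Type
  | a : AB
  | b : AB
deriving DecidableEq, Repr

/-- A (finite) word over {a, b}. -/
abbrev Word := List AB

open AB

/-- `u` occurs in `w` at position `i`. -/
def OccursAt (u w : Word) (i : ℕ) : Prop :=
  i + u.length ≤ w.length ∧ (w.drop i).take u.length = u

/-- `u` occurs exactly once in `w` (is unrepeated in `w`). -/
def OccursOnce (u w : Word) : Prop := ∃! i, OccursAt u w i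

/-- `u` is a right special factor of `w`: both `ua` and `ub` are factors of `w`. -/
def IsRightSpecial (u w : Word) : Prop := (u ++ [a]) <:+: w ∧ (u ++ [b]) <:+: w

/-- `u` is a left special factor of `w`: both `au` and `bu` are factors of `w`. -/
def IsLeftSpecial (u w : Word) : Prop := ([a] ++ u) <:+: w ∧ ([b] ++ u) <:+: w

/-- `K w`: the length of the shortest unrepeated suffix of `w`. -/
noncomputable def Kp (w : Word) : ℕ := sInf {n | ∃ s : Word, s <:+ w ∧ s.length = n ∧ OccursOnce s w}

/-- `H w`: the length of the shortest unrepeated prefix of `w`. -/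
noncomputable def Hp (w : Word) : ℕ := sInf {n | ∃ p : Word, p <+: w ∧ p.length = n ∧ OccursOnce p w}

/-- `R w`: the smallest `n ≥ 0` such that `w` has no right special factor of length `n`. -/
noncomputable def Rp (w : Word) : ℕ := sInf {n | ∀ u : Word, u.length = n → ¬ IsRightSpecial u w}

/-- `L w`: the smallest `n ≥ 0` such that `w` has no left special factor of length `n`. -/
noncomputable def Lp (w : Word) : ℕ := sInf {n | ∀ u : Word, u.length = n → ¬ IsLeftSpecial u w}

/-- A word `w` is trapezoidal if `|w| = K w + R w`. -/
def IsTrapezoidal (w : Word) : Prop := w.length = Kp w + Rp w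

/-- A finite word over `{a,b}` is Sturmian iff it is balanced: there is no word `u`
with both `aua` and `bub` factors of `w`. -/
def IsSturmian (w : Word) : Prop :=
  ¬ ∃ u : Word, ([a] ++ u ++ [a]) <:+: w ∧ ([b] ++ u ++ [b]) <:+: w

/-- A nonempty word is closed if it has a border (a proper prefix which is also a suffix)
whose only occurrences in `w` are as a prefix and as a suffix. -/
def IsClosedWord (w : Word) : Prop :=
  w ≠ [] ∧ ∃ v : Word, v <+: w ∧ v.length < w.length ∧ v <:+ w ∧
    ∀ i : ℕ, OccursAt v w i → i = 0 ∨ i + v.length = w.length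

/-- A nonempty word is open if it is not closed. -/
def IsOpenWord (w : Word) : Prop := w ≠ [] ∧ ¬ IsClosedWord w

/-- Central words: `a^n`, `b^n`, or `u a b v = v b a u`. -/
def IsCentral (w : Word) : Prop :=
  (∃ n : ℕ, w = List.replicate n a) ∨ (∃ n : ℕ, w = List.replicate n b) ∨
  (∃ u v : Word, w = u ++ [a, b] ++ v ∧ w = v ++ [b, a] ++ u)

/-- The minimal period of `w`: `|w|` minus the length of the longest border of `w`. -/
noncomputable def minPeriod (w : Word) : ℕ :=
  w.length - sSup {n | ∃ v : Word, v.length = n ∧ v <+: w ∧ v ≠ w ∧ v <:+ w}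

/-- The factors of length `m` at positions `p` and `q` of the sequence `f` coincide. -/
def SameFactor (f : ℕ → AB) (p q m : ℕ) : Prop := ∀ k < m, f (p + k) = f (q + k)

/-- Positions `p` and `q` below `N` carry the same factor of length `m`, followed by two
different letters; this factor is then right special. -/
def SpecialPair (f : ℕ → AB) (N m p q : ℕ) : Prop :=
  p + m < N ∧ q + m < N ∧ SameFactor f p q m ∧ f (p + m) ≠ f (q + m)

/-- The prefix of length `N` of `f` has at most one right special factor of each length. -/
def UniqueSpecial (f : ℕ → AB) (N : ℕ) : Prop :=
  ∀ m p q p' q', SpecialPair f N m p q → SpecialPair f N m p' q' → SameFactor f p p' m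

/-- Every repeated suffix of the prefix of length `N` of `f` agrees with the right special
factors of the same length. -/
def SuffixSpecial (f : ℕ → AB) (N : ℕ) : Prop :=
  ∀ m r p q, r + m < N → SameFactor f r (N - m) m → SpecialPair f N m p q → SameFactor f r p m

/-- `i` and `j` are the starting positions of two factors `xux` and `yuy` with `|u| = n`
and letters `x ≠ y`. -/
def Unbalanced (f : ℕ → AB) (N n i j : ℕ) : Prop :=
  i + n + 1 < N ∧ j + n + 1 < N ∧ SameFactor f (i + 1) (j + 1) n ∧
    f (i + n + 1) = f i ∧ f (j + n + 1) = f j ∧ f i ≠ f j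

theorem AB.eq_of_ne {x y z : AB} (hx : x ≠ z) (hy : y ≠ z) : x = y := by
  cases x <;> cases y <;> cases z <;> simp_all

namespace SameFactor

variable {f : ℕ → AB} {p q r m : ℕ}

theorem symm (h : SameFactor f p q m) : SameFactor f q p m := fun k hk => (h k hk).symm

theorem trans (h : SameFactor f p q m) (h' : SameFactor f q r m) : SameFactor f p r m :=
  fun k hk => (h k hk).trans (h' k hk)

theorem sub (h : SameFactor f p q m) {p' q' m' : ℕ} (d : ℕ) (hp : p' = p + d) (hq : q' = q + d)
    (hm : d + m' ≤ m) : SameFactor f p' q' m' := by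
  intro k hk
  have := h (d + k) (by omega)
  rwa [← Nat.add_assoc, ← Nat.add_assoc, ← hp, ← hq] at this

theorem get (h : SameFactor f p q m) {p' q' : ℕ} (d : ℕ) (hp : p' = p + d) (hq : q' = q + d)
    (hm : d < m) : f p' = f q' := by
  subst hp hq; exact h d hm

theorem cons (h0 : f p = f q) (h : SameFactor f (p + 1) (q + 1) m) :
    SameFactor f p q (m + 1) := by
  intro k hk
  rcases k with _ | k
  · exact h0
  · exact h.get k (by omega) (by omega) (by omega)

theorem concat (h : SameFactor f p q m) (h' : f (p + m) = f (q + m)) :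
    SameFactor f p q (m + 1) := by
  intro k hk
  rcases Nat.lt_succ_iff_lt_or_eq.1 hk with hk | rfl
  · exact h k hk
  · exact h'

end SameFactor

namespace Unbalanced

variable {f : ℕ → AB} {N n i j : ℕ}

theorem symm (h : Unbalanced f N n i j) : Unbalanced f N n j i := by
  obtain ⟨h1, h2, h3, h4, h5, h6⟩ := h
  exact ⟨h2, h1, h3.symm, h5, h4, h6.symm⟩

theorem specialPair (h : Unbalanced f N n i j) {m : ℕ} (hm : m ≤ n) :
    SpecialPair f N m (i + 1 + (n - m)) (j + 1 + (n - m)) := by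
  obtain ⟨h1, h2, h3, h4, h5, h6⟩ := h
  refine ⟨by omega, by omega, h3.sub (n - m) rfl rfl (by omega), ?_⟩
  rw [show i + 1 + (n - m) + m = i + n + 1 by omega,
    show j + 1 + (n - m) + m = j + n + 1 by omega, h4, h5]
  exact h6

theorem specialPair_self (h : Unbalanced f N n i j) : SpecialPair f N n (i + 1) (j + 1) := by
  simpa using h.specialPair le_rfl

end Unbalanced

section Counting

variable {f : ℕ → AB} {N : ℕ}

theorem UniqueSpecial.card_le (hU : UniqueSpecial f N) (m : ℕ) (S : Finset ℕ)
    (hS : ∀ p ∈ S, p + m ≤ N)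
    (hd : ∀ p ∈ S, ∀ q ∈ S, p ≠ q → ¬ SameFactor f p q m) : S.card ≤ m + 1 := by
  induction m generalizing S with
  | zero =>
    refine Finset.card_le_one.2 fun p hp q hq => ?_
    by_contra hpq
    exact hd p hp q hq hpq fun k hk => absurd hk (Nat.not_lt_zero k)
  | succ m ih =>
    by_cases hex : ∃ p ∈ S, ∃ q ∈ S, p ≠ q ∧ SameFactor f p q m
    · obtain ⟨p, hp, q, hq, hpq, hs⟩ := hex
      have special : ∀ p ∈ S, ∀ q ∈ S, p ≠ q → SameFactor f p q m → SpecialPair f N m p q :=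
        fun p hp q hq hpq hs => ⟨by have := hS p hp; omega, by have := hS q hq; omega, hs,
          fun he => hd p hp q hq hpq (hs.concat he)⟩
      have hcard := ih (S.erase p) (fun r hr => by
          have := hS r (Finset.mem_of_mem_erase hr); omega) (by
        intro p' hp' q' hq' hne hs'
        obtain ⟨hp1, hp2⟩ := Finset.mem_erase.1 hp'
        obtain ⟨hq1, hq2⟩ := Finset.mem_erase.1 hq'
        have h1 := special p hp q hq hpq hs
        have h2 := special p' hp2 q' hq2 hne hs'
        have h3 := hU m _ _ _ _ h1 h2
        have h4 := special p hp p' hp2 hp1.symm h3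
        have h5 := special p hp q' hq2 hq1.symm (h3.trans hs')
        exact h2.2.2.2 (AB.eq_of_ne h4.2.2.2.symm h5.2.2.2.symm))
      have := Finset.card_erase_add_one hp
      omega
    · push Not at hex
      have := ih S (fun r hr => by have := hS r hr; omega) hex
      omega

/-- Two occurrences of a factor of length `m` have the same continuation, as long as the right
special factor of length `m` is not met. -/
theorem UniqueSpecial.sameFactor_add (hU : UniqueSpecial f N) {m P Q p q : ℕ}
    (hPQ : SpecialPair f N m P Q) (hpq : p < q) (h : SameFactor f p q m) (d : ℕ)
    (hd : q + d + m ≤ N)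
    (hne : ∀ e < d, ¬ SameFactor f (q + e) P m ∨ f (p + e + m) = f (q + e + m)) :
    SameFactor f p q (m + d) := by
  induction d with
  | zero => exact h
  | succ d ih =>
    have hs := ih (by omega) fun e he => hne e (by omega)
    refine hs.concat ?_
    have hs' : SameFactor f (p + d) (q + d) m := hs.sub d rfl rfl (by omega)
    rw [show p + (m + d) = p + d + m by omega, show q + (m + d) = q + d + m by omega]
    by_contra hc
    rcases hne d (by omega) with h1 | h1
    · exact h1 (hs'.symm.trans (hU m _ _ _ _ ⟨by omega, by omega, hs', hc⟩ hPQ))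
    · exact hc h1

end Counting

section Returns

variable {f : ℕ → AB} {N n i₀ i₁ : ℕ}

theorem UniqueSpecial.return_le (hU : UniqueSpecial f N) {P Q i j : ℕ}
    (hPQ : SpecialPair f N n P Q) (hij : i < j) (hj : j + n ≤ N)
    (hoj : SameFactor f j P n) (hbetween : ∀ k, i < k → k < j → ¬ SameFactor f k P n) :
    j ≤ i + (n + 1) := by
  have key : ∀ p q, i ≤ p → p < q → q < j → ¬ SameFactor f p q n := by
    intro p q hp hpq hq hs
    have := hU.sameFactor_add hPQ hpq hs (j - q) (by omega)
      fun e he => Or.inl (hbetween _ (by omega) (by omega))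
    exact hbetween (p + (j - q)) (by omega) (by omega)
      ((this.sub (q' := j) (m' := n) (j - q) rfl (by omega) (by omega)).trans hoj)
  have := hU.card_le n (Finset.Ico i j)
    (fun p hp => by have := Finset.mem_Ico.1 hp; omega) (by
      intro p hp q hq hpq hs
      have hp := Finset.mem_Ico.1 hp
      have hq := Finset.mem_Ico.1 hq
      rcases Nat.lt_or_gt_of_ne hpq with h | h
      · exact key p q hp.1 h hq.2 hs
      · exact key q p hq.1 h hp.2 hs.symm)
  rw [Nat.card_Ico] at this
  omega

/-- A return to a palindromic right special factor `u` that starts with `ux` ends with `xu`. -/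
theorem UniqueSpecial.return_letter (hU : UniqueSpecial f N) {P Q i j : ℕ}
    (hPQ : SpecialPair f N n P Q) (hpal : ∀ k < n, f (P + k) = f (P + (n - 1 - k)))
    (hij : i < j) (hj : j + n ≤ N)
    (hoi : SameFactor f i P n) (hoj : SameFactor f j P n)
    (hbetween : ∀ k, i < k → k < j → ¬ SameFactor f k P n) : f (j - 1) = f (i + n) := by
  have hle := hU.return_le hPQ hij hj hoj hbetween
  rcases Nat.lt_or_ge (i + n) j with h | h
  · congr 1; omega
  · calc f (j - 1) = f (P + (j - 1 - i)) := hoi.get (j - 1 - i) (by omega) rfl (by omega)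
      _ = f (P + (n - 1 - (j - 1 - i))) := hpal _ (by omega)
      _ = f (i + n) := (hoj.get (n - 1 - (j - 1 - i)) (by omega) rfl (by omega)).symm

/-- If `xu` is always followed by `x` before position `J`, then an occurrence of `u` at
position `J` that follows `xux` cannot be preceded by a letter other than `x`. -/
theorem UniqueSpecial.not_follows (hU : UniqueSpecial f N) {P Q J : ℕ} {x : AB}
    (hPQ : SpecialPair f N n P Q) (hpal : ∀ k < n, f (P + k) = f (P + (n - 1 - k)))
    (hJN : J + n ≤ N) (hJ : SameFactor f J P n) (hJx : f (J - 1) ≠ x)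
    (hfollow : ∀ p, p + 1 < J → f p = x → SameFactor f (p + 1) P n → f (p + 1 + n) = x)
    (p : ℕ) (hpJ : p + 1 < J) (hp : f p = x) : ¬ SameFactor f (p + 1) P n := by
  intro hs
  induction hd : J - p using Nat.strong_induction_on generalizing p with
  | _ d ih =>
    classical
    have hex : ∃ j, p + 1 < j ∧ SameFactor f j P n := ⟨J, hpJ, hJ⟩
    obtain ⟨hj1, hj2⟩ := Nat.find_spec hex
    have hmin : ∀ k, p + 1 < k → k < Nat.find hex → ¬ SameFactor f k P n :=
      fun k hk hk' hc => Nat.find_min hex hk' ⟨hk, hc⟩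
    have hjJ : Nat.find hex ≤ J := Nat.find_min' hex ⟨hpJ, hJ⟩
    generalize Nat.find hex = j at *
    have hlet := hU.return_letter hPQ hpal hj1 (by omega) hs hj2 hmin
    rw [hfollow p hpJ hp hs] at hlet
    have hne : j ≠ J := by rintro rfl; exact hJx hlet
    have hj : j - 1 + 1 = j := by omega
    exact ih (J - (j - 1)) (by omega) (j - 1) (by omega) hlet (by rwa [hj]) rfl

end Returns

section Main

variable {f : ℕ → AB} {N n i j : ℕ}

theorem letter_eq_of_long_repeated_suffix (hU : UniqueSpecial f N) (hS : SuffixSpecial f N)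
    (h : Unbalanced f N n i j)
    (hpal : ∀ k < n, f (i + 1 + k) = f (i + 1 + (n - 1 - k)))
    {r : ℕ} (hr : r + (n + 1) < N) (hrs : SameFactor f r (N - (n + 1)) (n + 1)) :
    f (N - (n + 1)) = f i := by
  by_contra hy
  have hocc : SameFactor f (N - n) (i + 1) n :=
    (hrs.symm.sub (m' := n) 1 (by omega) rfl (by omega)).trans
      (hS n (r + 1) _ _ (by omega) (hrs.sub 1 rfl (by omega) (by omega)) h.specialPair_self)
  refine hU.not_follows (x := f i) h.specialPair_self hpal (by omega) hocc ?_ ?_ i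
    (by have := h.1; omega) rfl fun k _ => rfl
  · rwa [show N - n - 1 = N - (n + 1) by omega]
  · intro p hpN hp hs
    by_contra hne
    have hpair : SpecialPair f N (n + 1) i p := by
      refine ⟨by have := h.1; omega, by omega, SameFactor.cons hp.symm hs.symm, ?_⟩
      rw [← Nat.add_assoc, h.2.2.2.1, show p + (n + 1) = p + 1 + n by omega]
      exact Ne.symm hne
    have hri := hS _ r _ _ hr hrs hpair
    exact hy ((hrs 0 (by omega)).symm.trans (hri 0 (by omega)))

theorem letter_eq_of_short_repeated_suffix (hU : UniqueSpecial f N)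
    (h : Unbalanced f N n i j)
    (hpal : ∀ k < n, f (i + 1 + k) = f (i + 1 + (n - 1 - k)))
    {m g : ℕ} (hmn : m < n)
    (hg : g + m < N) (hgi : SameFactor f g (i + 1 + (n - m)) m)
    (hmax : ∀ g', g < g' → g' + m < N → ¬ SameFactor f g' (i + 1 + (n - m)) m)
    (hunrep : ∀ r, r + (m + 1) < N → ¬ SameFactor f r (N - (m + 1)) (m + 1)) :
    f (g + m) = f i := by
  by_contra hz
  have hzj : f (g + m) = f j := AB.eq_of_ne hz h.2.2.2.2.2.symm
  have hspec := h.specialPair hmn.le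
  obtain ⟨hi, hj, hij, hii, hjj, hne⟩ := h
  -- the factor of length `m` at `g`, followed by its letter, occurs nowhere else
  have huniq : ∀ g', g' + m < N → SameFactor f g' (i + 1 + (n - m)) m →
      f (g' + m) = f (g + m) → g' = g := by
    intro g' hg' hs hlet
    by_contra hgg
    have hlt : g' < g := by
      by_contra hc
      exact hmax g' (by omega) hg' hs
    have := hU.sameFactor_add hspec hlt (hs.trans hgi.symm) (N - m - g) (by omega) (by
      intro e he
      rcases Nat.eq_zero_or_pos e with rfl | he0
      · exact Or.inr hlet
      · exact Or.inl (hmax _ (by omega) (by omega)))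
    exact hunrep (g' + (N - m - g - 1)) (by omega)
      (this.sub (N - m - g - 1) rfl (by omega) (by omega))
  have hgj : j + 1 + (n - m) = g := by
    refine huniq _ (by omega) (hij.symm.sub (n - m) rfl rfl (by omega)) ?_
    rw [hzj, ← hjj]; congr 1; omega
  have hbefore : i + 1 < j + 1 := by
    have hle : i + 1 + (n - m) ≤ g := by
      by_contra hc
      exact hmax _ (by omega) (by omega) fun k _ => rfl
    rcases Nat.lt_or_ge i j with hlt | hge
    · omega
    · exact absurd (by rw [show i = j by omega]) hne
  refine hU.not_follows (x := f i) (P := i + 1) (Q := j + 1) ⟨by omega, by omega, hij, ?_⟩ hpal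
    (by omega) hij.symm hne.symm ?_ i hbefore rfl fun k _ => rfl
  · rw [show i + 1 + n = i + n + 1 by omega, show j + 1 + n = j + n + 1 by omega, hii, hjj]
    exact hne
  · intro p hpj hp hs
    by_contra hc
    have := huniq (p + 1 + (n - m)) (by omega) (hs.sub (n - m) rfl rfl (by omega)) (by
      rw [hzj, show p + 1 + (n - m) + m = p + 1 + n by omega]
      exact AB.eq_of_ne hc hne.symm)
    omega

theorem not_unbalanced_of_palindrome (hU : UniqueSpecial f N) (hS : SuffixSpecial f N)
    (h : Unbalanced f N n i j)
    (hpal : ∀ k < n, f (i + 1 + k) = f (i + 1 + (n - 1 - k))) : False := by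
  have hpal' : ∀ k < n, f (j + 1 + k) = f (j + 1 + (n - 1 - k)) := fun k hk => by
    rw [← h.2.2.1 k hk, ← h.2.2.1 (n - 1 - k) (by omega), hpal k hk]
  have hN := h.1
  classical
  by_cases hlong : ∃ r, r + (n + 1) < N ∧ SameFactor f r (N - (n + 1)) (n + 1)
  · obtain ⟨r, hr, hrs⟩ := hlong
    have h1 := letter_eq_of_long_repeated_suffix hU hS h hpal hr hrs
    have h2 := letter_eq_of_long_repeated_suffix hU hS h.symm hpal' hr hrs
    exact h.2.2.2.2.2 (h1.symm.trans h2)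
  have hex : ∃ m, ¬ ∃ r, r + (m + 1) < N ∧ SameFactor f r (N - (m + 1)) (m + 1) := ⟨n, hlong⟩
  have hunrep := Nat.find_spec hex
  have hmn : Nat.find hex ≤ n := Nat.find_min' hex hlong
  have hrep : ∃ r, r + Nat.find hex < N ∧
      SameFactor f r (N - Nat.find hex) (Nat.find hex) := by
    rcases hm : Nat.find hex with _ | m
    · exact ⟨0, by omega, fun k hk => absurd hk (Nat.not_lt_zero k)⟩
    · exact not_not.1 (Nat.find_min hex (m := m) (by omega))
  generalize Nat.find hex = m at *
  push Not at hunrep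
  obtain ⟨r, hr, hrs⟩ := hrep
  have hri := hS m r _ _ hr hrs (h.specialPair hmn)
  have hend := hrs.symm.trans hri
  rcases Nat.lt_or_eq_of_le hmn with hlt | rfl
  · let good : ℕ → Prop := fun g => g + m < N ∧ SameFactor f g (i + 1 + (n - m)) m
    have hgood : good (Nat.findGreatest good N) :=
      Nat.findGreatest_spec (P := good) (m := r) (by omega) ⟨hr, hri⟩
    have hmax : ∀ g', Nat.findGreatest good N < g' → g' + m < N →
        ¬ SameFactor f g' (i + 1 + (n - m)) m := fun g' h1 h2 h3 =>
      Nat.findGreatest_is_greatest h1 (by omega) ⟨h2, h3⟩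
    have hsw : SameFactor f (i + 1 + (n - m)) (j + 1 + (n - m)) m := (h.specialPair hmn).2.2.1
    have h1 := letter_eq_of_short_repeated_suffix hU h hpal hlt hgood.1 hgood.2 hmax hunrep
    have h2 := letter_eq_of_short_repeated_suffix hU h.symm hpal' hlt hgood.1
      (hgood.2.trans hsw)
      (fun g' h1 h2 h3 => hmax g' h1 h2 (h3.trans hsw.symm)) hunrep
    exact h.2.2.2.2.2 (h1.symm.trans h2)
  · have hocc : SameFactor f (i + 1) (N - (m + 1) + 1) m := by
      simpa [show N - (m + 1) + 1 = N - m by omega] using hend.symm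
    by_cases hy : f (N - (m + 1)) = f i
    · exact hunrep i (by omega) (SameFactor.cons hy.symm hocc)
    · exact hunrep j (by have := h.2.1; omega)
        (SameFactor.cons (AB.eq_of_ne h.2.2.2.2.2.symm hy) (h.2.2.1.symm.trans hocc))

end Main

section Balance

variable {f : ℕ → AB} {N : ℕ}

/-- The number of letters `a` in the factor of length `m` at position `p`. -/
def countA (f : ℕ → AB) (p m : ℕ) : ℕ := ∑ k ∈ Finset.range m, if f (p + k) = a then 1 else 0

theorem countA_add (f : ℕ → AB) (p m l : ℕ) :
    countA f p (m + l) = countA f p m + countA f (p + m) l := by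
  simp only [countA, Finset.sum_range_add, Nat.add_assoc]

theorem countA_one (f : ℕ → AB) (p : ℕ) : countA f p 1 = if f p = a then 1 else 0 := by
  rw [countA, Finset.sum_range_one, Nat.add_zero]

theorem SameFactor.countA_eq {p q m : ℕ} (h : SameFactor f p q m) :
    countA f p m = countA f q m :=
  Finset.sum_congr rfl fun k hk => by rw [h k (Finset.mem_range.1 hk)]

theorem exists_unbalanced_of_countA (L p q : ℕ) (hp : p + L ≤ N) (hq : q + L ≤ N)
    (hc : countA f q L + 2 ≤ countA f p L) :
    ∃ n i j, n + 2 ≤ L ∧ Unbalanced f N n i j := by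
  induction L using Nat.strong_induction_on generalizing p q with
  | _ L ih =>
    rcases L with _ | L
    · simp [countA] at hc
    have hpL : countA f p (L + 1) = countA f p 1 + countA f (p + 1) L := by
      rw [Nat.add_comm, countA_add]
    have hqL : countA f q (L + 1) = countA f q 1 + countA f (q + 1) L := by
      rw [Nat.add_comm, countA_add]
    rw [countA_one] at hpL hqL
    by_cases hpq : f p = a ∧ f q ≠ a
    · obtain ⟨hpa, hqa⟩ := hpq
      rw [if_pos hpa] at hpL
      rw [if_neg hqa] at hqL
      have hex : ∃ k, k < L ∧ f (p + 1 + k) ≠ f (q + 1 + k) := by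
        by_contra hc'
        push Not at hc'
        have := SameFactor.countA_eq (f := f) (p := p + 1) (q := q + 1) (m := L) hc'
        omega
      classical
      obtain ⟨hk, hkne⟩ := Nat.find_spec hex
      have hmin : SameFactor f (p + 1) (q + 1) (Nat.find hex) := fun k hk' => by
        by_contra hne
        exact Nat.find_min hex hk' ⟨by omega, hne⟩
      generalize Nat.find hex = k at *
      by_cases hka : f (p + 1 + k) = a
      · refine ⟨k, p, q, by omega, by omega, by omega, hmin, ?_, ?_, ?_⟩
        · rw [hpa, ← hka]; congr 1; omega
        · rw [show q + k + 1 = q + 1 + k by omega]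
          exact AB.eq_of_ne (hka ▸ hkne.symm) hqa
        · rw [hpa]; exact hqa.symm
      · have hkb : f (q + 1 + k) = a := AB.eq_of_ne hkne.symm (Ne.symm hka)
        have h1 := countA_add f (p + 1) (k + 1) (L - (k + 1))
        have h2 := countA_add f (q + 1) (k + 1) (L - (k + 1))
        rw [countA_add _ _ k 1, countA_one, show k + 1 + (L - (k + 1)) = L by omega] at h1 h2
        rw [if_neg hka] at h1
        rw [if_pos hkb] at h2
        have h3 := hmin.countA_eq
        obtain ⟨n, i, j, hn, hu⟩ := ih (L - (k + 1)) (by omega) (p + 1 + (k + 1))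
          (q + 1 + (k + 1)) (by omega) (by omega) (by omega)
        exact ⟨n, i, j, by omega, hu⟩
    · have : (if f p = a then 1 else 0) ≤ (if f q = a then 1 else 0) := by
        split_ifs <;> simp_all
      obtain ⟨n, i, j, hn, hu⟩ := ih L (by omega) (p + 1) (q + 1) (by omega) (by omega) (by omega)
      exact ⟨n, i, j, by omega, hu⟩

theorem Unbalanced.palindrome {n i j : ℕ} (h : Unbalanced f N n i j)
    (hmin : ∀ n' < n, ∀ i' j', ¬ Unbalanced f N n' i' j') :
    ∀ k < n, f (i + 1 + k) = f (i + 1 + (n - 1 - k)) := by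
  by_contra hex
  push Not at hex
  wlog hia : f i = a generalizing i j
  · have hs : ∀ k < n, f (i + 1 + k) = f (j + 1 + k) := h.2.2.1
    refine this h.symm ?_ (AB.eq_of_ne h.2.2.2.2.2.symm (Ne.symm hia))
    obtain ⟨k, hk, hne⟩ := hex
    exact ⟨k, hk, by rwa [← hs k hk, ← hs _ (by omega)]⟩
  classical
  obtain ⟨hk, hkne⟩ := Nat.find_spec hex
  have hlow : ∀ k' < Nat.find hex, f (i + 1 + k') = f (i + 1 + (n - 1 - k')) := fun k' hk' => by
    by_contra hne
    exact Nat.find_min hex hk' ⟨by omega, hne⟩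
  generalize Nat.find hex = k at *
  obtain ⟨hi, hj, hij, hii, hjj, hne⟩ := h
  have hja : f j ≠ a := hia ▸ hne.symm
  have hrefl : countA f (i + 1) k = countA f (i + 1 + (n - k)) k := by
    unfold countA
    rw [← Finset.sum_range_reflect]
    refine Finset.sum_congr rfl fun l hl => ?_
    have hl := Finset.mem_range.1 hl
    rw [hlow _ (by omega), show i + 1 + (n - 1 - (k - 1 - l)) = i + 1 + (n - k) + l by omega]
  have hpre : countA f (i + 1) k = countA f (j + 1) k :=
    (hij.sub 0 rfl rfl (by omega) : SameFactor f (i + 1) (j + 1) k).countA_eq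
  have hsuf : countA f (i + 1 + (n - k)) k = countA f (j + 1 + (n - k)) k :=
    (hij.sub (n - k) rfl rfl (by omega)).countA_eq
  have hsplit : ∀ p, countA f p (k + 2) =
      (if f p = a then 1 else 0) + countA f (p + 1) k + if f (p + 1 + k) = a then 1 else 0 := by
    intro p
    rw [show k + 2 = 1 + k + 1 by omega, countA_add, countA_add, countA_one, countA_one,
      ← Nat.add_assoc]
  have hlast : j + 1 + (n - 1 - k) + 1 = j + 1 + (n - k) := by omega
  have hlast' : i + 1 + (n - 1 - k) + 1 = i + 1 + (n - k) := by omega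
  have hendi : f (i + 1 + (n - k) + k) = a := by
    rw [← hia, ← hii]; congr 1; omega
  have hendj : f (j + 1 + (n - k) + k) ≠ a := by
    rw [show j + 1 + (n - k) + k = j + n + 1 by omega, hjj]; exact hja
  have hcount : ∃ p q, p + (k + 2) ≤ N ∧ q + (k + 2) ≤ N ∧
      countA f q (k + 2) + 2 ≤ countA f p (k + 2) := by
    by_cases hka : f (i + 1 + k) = a
    · refine ⟨i, j + 1 + (n - 1 - k), by omega, by omega, ?_⟩
      have hkb : f (j + 1 + (n - 1 - k)) ≠ a := by
        rw [← hij _ (by omega), ← hka]; exact hkne.symm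
      rw [hsplit, hsplit, hlast, if_pos hia, if_pos hka, if_neg hkb, if_neg hendj]
      omega
    · refine ⟨i + 1 + (n - 1 - k), j, by omega, by omega, ?_⟩
      have hkb : f (i + 1 + (n - 1 - k)) = a := AB.eq_of_ne hkne.symm (Ne.symm hka)
      have hkj : f (j + 1 + k) ≠ a := by rwa [← hij _ hk]
      rw [hsplit, hsplit, hlast', if_pos hkb, if_pos hendi, if_neg hja, if_neg hkj]
      omega
  obtain ⟨p, q, hp, hq, hc⟩ := hcount
  obtain ⟨n', i', j', hn', hu⟩ := exists_unbalanced_of_countA _ _ _ hp hq hc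
  exact hmin n' (by omega) i' j' hu

theorem not_unbalanced (hU : UniqueSpecial f N) (hS : SuffixSpecial f N) {n i j : ℕ} :
    ¬ Unbalanced f N n i j := by
  intro h
  classical
  have hex : ∃ n i j, Unbalanced f N n i j := ⟨n, i, j, h⟩
  obtain ⟨i, j, h⟩ := Nat.find_spec hex
  exact not_unbalanced_of_palindrome hU hS h
    (h.palindrome fun n' hn' i' j' h' => Nat.find_min hex hn' ⟨i', j', h'⟩)

end Balance

section Trapezoidal

/-- A word has at most one right special factor of each length. -/
def UniqueRightSpecial (w : Word) : Prop :=
  ∀ u v : Word, u.length = v.length → IsRightSpecial u w → IsRightSpecial v w → u = v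

theorem occursAt_iff {u w : Word} {i : ℕ} :
    OccursAt u w i ↔ ∃ x y, x.length = i ∧ w = x ++ u ++ y := by
  constructor
  · rintro ⟨h1, h2⟩
    refine ⟨w.take i, (w.drop i).drop u.length, by simp; omega, ?_⟩
    conv_lhs => rw [← List.take_append_drop i w, ← List.take_append_drop u.length (w.drop i), h2]
    rw [List.append_assoc]
  · rintro ⟨x, y, rfl, rfl⟩
    constructor <;> simp

theorem not_occursOnce_iff {t w : Word} (ht : t <:+ w) :
    ¬ OccursOnce t w ↔ ∃ d, t ++ [d] <:+: w := by
  obtain ⟨x, rfl⟩ := ht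
  have hx : OccursAt t (x ++ t) x.length := occursAt_iff.2 ⟨x, [], rfl, by simp⟩
  constructor
  · intro h
    by_contra hc
    push Not at hc
    refine h ⟨x.length, hx, fun i hi => ?_⟩
    obtain ⟨y, z, rfl, he⟩ := occursAt_iff.1 hi
    rcases z with _ | ⟨d, z⟩
    · have := congrArg List.length he
      simp at this
      exact this.symm
    · exact absurd ⟨y, z, by rw [he]; simp⟩ (hc d)
  · rintro ⟨d, y, z, he⟩ ⟨i, -, hi⟩
    have h1 := hi _ hx
    have h2 := hi y.length (occursAt_iff.2 ⟨y, d :: z, rfl, by rw [← he]; simp⟩)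
    have := congrArg List.length he
    simp at this
    omega

theorem exists_suffix_length_Kp (w : Word) :
    ∃ t, t <:+ w ∧ t.length = Kp w ∧ ∀ d, ¬ t ++ [d] <:+: w := by
  have hne : {n | ∃ s : Word, s <:+ w ∧ s.length = n ∧ OccursOnce s w}.Nonempty := by
    refine ⟨w.length, w, List.suffix_refl w, rfl, ?_⟩
    by_contra hc
    obtain ⟨d, hd⟩ := (not_occursOnce_iff (List.suffix_refl w)).1 hc
    have := hd.length_le
    simp at this
  obtain ⟨t, h1, h2, h3⟩ := Nat.sInf_mem hne
  refine ⟨t, h1, h2, fun d hd => ?_⟩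
  exact (not_occursOnce_iff h1).2 ⟨d, hd⟩ h3

theorem Kp_le {t w : Word} (ht : t <:+ w) (h : ∀ d, ¬ t ++ [d] <:+: w) : Kp w ≤ t.length := by
  refine Nat.sInf_le ⟨t, ht, rfl, ?_⟩
  by_contra hc
  obtain ⟨d, hd⟩ := (not_occursOnce_iff ht).1 hc
  exact h d hd

theorem length_lt_Kp {t w : Word} {d : AB} (ht : t <:+ w) (h : t ++ [d] <:+: w) :
    t.length < Kp w := by
  obtain ⟨s, hs, hl, hn⟩ := exists_suffix_length_Kp w
  by_contra hc
  have hst : s <:+ t := List.suffix_of_suffix_length_le hs ht (by omega)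
  obtain ⟨x, rfl⟩ := hst
  exact hn d (List.IsInfix.trans ⟨x, [], by simp⟩ h)

theorem append_singleton_infix_concat_iff {u w : Word} {c d : AB} :
    u ++ [c] <:+: w ++ [d] ↔ u ++ [c] <:+: w ∨ (c = d ∧ u <:+ w) := by
  rw [List.infix_concat_iff, or_comm, List.suffix_concat_iff]
  constructor
  · rintro (h | h | ⟨t, h1, h2⟩)
    · exact Or.inl h
    · simp at h
    · obtain ⟨rfl, h3⟩ := List.append_inj' h1 rfl
      exact Or.inr ⟨by simpa using h3, h2⟩
  · rintro (h | ⟨rfl, h⟩)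
    · exact Or.inl h
    · exact Or.inr (Or.inr ⟨u, rfl, h⟩)

theorem Kp_concat_le (w : Word) (d : AB) : Kp (w ++ [d]) ≤ Kp w + 1 := by
  obtain ⟨t, ht, hl, hn⟩ := exists_suffix_length_Kp w
  have : Kp (w ++ [d]) ≤ (t ++ [d]).length := by
    refine Kp_le ?_ fun e he => ?_
    · obtain ⟨x, rfl⟩ := ht
      exact ⟨x, by simp⟩
    · rcases append_singleton_infix_concat_iff.1 he with h | ⟨-, h⟩
      · exact hn d (List.IsInfix.trans ⟨[], [e], by simp⟩ h)
      · exact hn d h.isInfix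
  simpa [hl] using this

open Classical in
/-- The right special factors of a word. -/
noncomputable def rightSpecialFactors (w : Word) : Finset Word :=
  w.sublists.toFinset.filter fun u => IsRightSpecial u w

theorem mem_rightSpecialFactors {u w : Word} :
    u ∈ rightSpecialFactors w ↔ IsRightSpecial u w := by
  simp only [rightSpecialFactors, Finset.mem_filter, List.mem_toFinset, List.mem_sublists,
    and_iff_right_iff_imp]
  exact fun h => (List.IsInfix.trans ⟨[], [a], by simp⟩ h.1).sublist

theorem card_rightSpecialFactors_concat_le (w : Word) (d : AB) :
    (rightSpecialFactors (w ++ [d])).card ≤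
      (rightSpecialFactors w).card + (Kp w + 1 - Kp (w ++ [d])) := by
  classical
  have key : ∀ u, IsRightSpecial u (w ++ [d]) → ¬ IsRightSpecial u w →
      u <:+ w ∧ u.length < Kp w ∧ Kp (w ++ [d]) ≤ u.length + 1 := by
    intro u hu hu'
    have hsuf : u <:+ w ∧ (∃ e, u ++ [e] <:+: w) ∧ ¬ u ++ [d] <:+: w := by
      obtain ⟨h1, h2⟩ := hu
      unfold IsRightSpecial at hu'
      rw [append_singleton_infix_concat_iff] at h1 h2
      rcases h1 with h1 | ⟨rfl, h1⟩ <;> rcases h2 with h2 | ⟨h2', h2⟩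
      · exact absurd ⟨h1, h2⟩ hu'
      · subst h2'; exact ⟨h2, ⟨_, h1⟩, fun h => hu' ⟨h1, h⟩⟩
      · exact ⟨h1, ⟨_, h2⟩, fun h => hu' ⟨h, h2⟩⟩
      · cases h2'
    obtain ⟨h1, ⟨e, h2⟩, h3⟩ := hsuf
    refine ⟨h1, length_lt_Kp h1 h2, ?_⟩
    have : Kp (w ++ [d]) ≤ (u ++ [d]).length := by
      refine Kp_le ?_ fun e he => ?_
      · obtain ⟨x, rfl⟩ := h1
        exact ⟨x, by simp⟩
      · rcases append_singleton_infix_concat_iff.1 he with h | ⟨-, h⟩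
        · exact h3 (List.IsInfix.trans ⟨[], [e], by simp⟩ h)
        · exact h3 h.isInfix
    simpa using this
  have hsub : rightSpecialFactors (w ++ [d]) ⊆ rightSpecialFactors w ∪
      (Finset.Ico (Kp (w ++ [d]) - 1) (Kp w)).image fun l => w.drop (w.length - l) := by
    intro u hu
    rw [Finset.mem_union]
    by_cases h : u ∈ rightSpecialFactors w
    · exact Or.inl h
    · obtain ⟨h1, h2, h3⟩ := key u (mem_rightSpecialFactors.1 hu)
        fun h' => h (mem_rightSpecialFactors.2 h')
      refine Or.inr (Finset.mem_image.2 ⟨u.length, Finset.mem_Ico.2 ⟨by omega, h2⟩, ?_⟩)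
      exact (List.suffix_iff_eq_drop.1 h1).symm
  have hpos : 0 < Kp (w ++ [d]) := length_lt_Kp (d := d) (t := []) (List.nil_suffix)
    ⟨w, [], by simp⟩
  calc _ ≤ _ := Finset.card_le_card hsub
    _ ≤ _ := Finset.card_union_le _ _
    _ ≤ _ := Nat.add_le_add_left Finset.card_image_le _
    _ ≤ _ := by rw [Nat.card_Ico]; omega

theorem card_rightSpecialFactors_add_Kp_le (w : Word) :
    (rightSpecialFactors w).card + Kp w ≤ w.length := by
  induction w using List.reverseRecOn with
  | nil =>
    have h1 : Kp [] ≤ 0 := Kp_le (t := []) (List.suffix_refl _) fun d hd => by simp at hd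
    have h2 : rightSpecialFactors [] = ∅ := by
      refine Finset.eq_empty_of_forall_notMem fun u hu => ?_
      have := (mem_rightSpecialFactors.1 hu).1
      simp at this
    simp [h2]; omega
  | append_singleton w d ih =>
    have h1 := card_rightSpecialFactors_concat_le w d
    have h2 := Kp_concat_le w d
    simp
    omega

theorem IsTrapezoidal.uniqueRightSpecial {w : Word} (h : IsTrapezoidal w) :
    UniqueRightSpecial w := by
  have hrange : Finset.range (Rp w) ⊆ (rightSpecialFactors w).image List.length := by
    intro n hn
    have := Nat.notMem_of_lt_sInf (Finset.mem_range.1 hn)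
    simp only [Set.mem_ofPred_eq, not_forall, not_not] at this
    obtain ⟨u, hl, hu⟩ := this
    exact Finset.mem_image.2 ⟨u, mem_rightSpecialFactors.2 hu, hl⟩
  have h1 := Finset.card_le_card hrange
  rw [Finset.card_range] at h1
  have h2 : ((rightSpecialFactors w).image List.length).card ≤ (rightSpecialFactors w).card :=
    Finset.card_image_le
  have h3 := card_rightSpecialFactors_add_Kp_le w
  have h4 : w.length = Kp w + Rp w := h
  have hinj := Finset.card_image_iff.1 (show ((rightSpecialFactors w).image List.length).card =
    (rightSpecialFactors w).card by omega)
  intro u v hl hu hv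
  exact hinj (mem_rightSpecialFactors.2 hu) (mem_rightSpecialFactors.2 hv) hl

end Trapezoidal

section Letters

/-- The letters of a word as a sequence, continued by the letter `a`. -/
def letters (w : Word) (k : ℕ) : AB := w.getD k a

/-- The factor of length `m` of `w` at position `p`. -/
def factor (w : Word) (p m : ℕ) : Word := (w.drop p).take m

variable {w : Word} {p q m : ℕ}

theorem length_factor (h : p + m ≤ w.length) : (factor w p m).length = m := by
  simp [factor]; omega

theorem factor_succ (h : p + m < w.length) :
    factor w p (m + 1) = factor w p m ++ [letters w (p + m)] := by
  simp [factor, letters, List.take_add_one, List.getElem?_drop, h]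

theorem factor_infix (w : Word) (p m : ℕ) : factor w p m <:+: w :=
  (List.take_prefix _ _).isInfix.trans (List.drop_suffix _ _).isInfix

theorem sameFactor_iff (hp : p + m ≤ w.length) (hq : q + m ≤ w.length) :
    SameFactor (letters w) p q m ↔ factor w p m = factor w q m := by
  induction m with
  | zero => simp [factor, SameFactor]
  | succ m ih =>
    have ih := ih (by omega) (by omega)
    rw [factor_succ (by omega), factor_succ (by omega)]
    constructor
    · intro h
      rw [ih.1 (h.sub 0 rfl rfl (by omega)), h m (by omega)]
    · intro h
      obtain ⟨h1, h2⟩ := List.append_inj' h rfl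
      exact (ih.2 h1).concat (by simpa using h2)

theorem isRightSpecial_of_ne {u : Word} {c d : AB} (hc : u ++ [c] <:+: w) (hd : u ++ [d] <:+: w)
    (hne : c ≠ d) : IsRightSpecial u w := by
  cases c <;> cases d <;> first | exact absurd rfl hne | exact ⟨hc, hd⟩ | exact ⟨hd, hc⟩

theorem SpecialPair.isRightSpecial (h : SpecialPair (letters w) w.length m p q) :
    IsRightSpecial (factor w p m) w := by
  obtain ⟨hp, hq, hs, hne⟩ := h
  refine isRightSpecial_of_ne (c := letters w (p + m)) (d := letters w (q + m)) ?_ ?_ hne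
  · rw [← factor_succ hp]; exact factor_infix _ _ _
  · rw [(sameFactor_iff hp.le hq.le).1 hs, ← factor_succ hq]; exact factor_infix _ _ _

theorem UniqueRightSpecial.uniqueSpecial (h : UniqueRightSpecial w) :
    UniqueSpecial (letters w) w.length := by
  intro m p q p' q' h1 h2
  refine (sameFactor_iff h1.1.le h2.1.le).2 (h _ _ ?_ h1.isRightSpecial h2.isRightSpecial)
  rw [length_factor h1.1.le, length_factor h2.1.le]

theorem IsRightSpecial.concat {u : Word} (h : IsRightSpecial u w) (c : AB) :
    IsRightSpecial u (w ++ [c]) :=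
  ⟨h.1.trans (List.prefix_append _ _).isInfix, h.2.trans (List.prefix_append _ _).isInfix⟩

theorem suffixSpecial_of_concat (h : ∀ c, UniqueRightSpecial (w ++ [c])) :
    SuffixSpecial (letters w) w.length := by
  intro m r p q hr hs hpq
  refine (sameFactor_iff hr.le hpq.1.le).2 ?_
  obtain ⟨c, hc⟩ : ∃ c, letters w (r + m) ≠ c := by
    cases letters w (r + m)
    · exact ⟨b, by simp⟩
    · exact ⟨a, by simp⟩
  refine h c _ _ ?_ (isRightSpecial_of_ne ?_ ?_ hc) (hpq.isRightSpecial.concat c)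
  · rw [length_factor hr.le, length_factor hpq.1.le]
  · rw [← factor_succ hr]
    exact (factor_infix _ _ _).trans (List.prefix_append _ _).isInfix
  · refine append_singleton_infix_concat_iff.2 (Or.inr ⟨rfl, ?_⟩)
    rw [(sameFactor_iff hr.le (by omega)).1 hs, factor, List.take_of_length_le (by simp; omega)]
    exact List.drop_suffix _ _

theorem exists_letters_of_infix {u : Word} (h : u <:+: w) :
    ∃ i, i + u.length ≤ w.length ∧ ∀ k < u.length, letters w (i + k) = letters u k := by
  obtain ⟨x, y, rfl⟩ := h
  refine ⟨x.length, by simp, fun k hk => ?_⟩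
  simp [letters, List.getElem?_append, hk]

end Letters

/-- every right special trapezoidal word is Sturmian. -/
theorem right_special_trapezoidal_is_sturmian (w : Word)
    (htrap : IsTrapezoidal w)
    (ha : IsTrapezoidal (w ++ [AB.a])) (hb : IsTrapezoidal (w ++ [AB.b])) :
    IsSturmian w := by
  rintro ⟨u, hua, hub⟩
  obtain ⟨i, hi, hi'⟩ := exists_letters_of_infix hua
  obtain ⟨j, hj, hj'⟩ := exists_letters_of_infix hub
  have hS : SuffixSpecial (letters w) w.length := suffixSpecial_of_concat fun c => by
    cases c
    exacts [ha.uniqueRightSpecial, hb.uniqueRightSpecial]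
  have hends : ∀ c : AB, letters ([c] ++ u ++ [c]) 0 = c ∧
      letters ([c] ++ u ++ [c]) (u.length + 1) = c ∧
      ∀ k < u.length, letters ([c] ++ u ++ [c]) (k + 1) = letters u k := fun c =>
    ⟨by simp [letters], by simp [letters], fun k hk => by
      simp [letters, List.getElem?_append, hk]⟩
  simp only [List.length_append, List.length_singleton] at hi hi' hj hj'
  have hi0 : letters w i = a := (hi' 0 (by omega)).trans (hends a).1
  have hj0 : letters w j = b := (hj' 0 (by omega)).trans (hends b).1
  refine not_unbalanced htrap.uniqueRightSpecial.uniqueSpecial hS (n := u.length) (i := i) (j := j)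
    ⟨by omega, by omega, fun k hk => ?_, ?_, ?_, ?_⟩
  · rw [show i + 1 + k = i + (k + 1) by omega, show j + 1 + k = j + (k + 1) by omega,
      hi' _ (by omega), hj' _ (by omega), (hends a).2.2 k hk, (hends b).2.2 k hk]
  · rw [hi0, Nat.add_assoc, hi' _ (by omega), (hends a).2.1]
  · rw [hj0, Nat.add_assoc, hj' _ (by omega), (hends b).2.1]
  · rw [hi0, hj0]; simp
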